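/- Fix integers d ≥ 1, P ≥ 1 and a core tensor W ∈ ℝ^{P×P×P}. There exists r ∈ ℝ^{d×P} with r ≠ 0 such that f(h,r,t) = f(t,r,h) for all h, t ∈ ℝ^{d×P} if and only if rank(W_(2)ᵀ − S·W_(2)ᵀ) < P. -/

import Mathlib

open scoped BigOperators
open Matrix

/-- The TDB scoring function `f(h,r,t) = Σ_{l,m,n} W_{lmn} Σ_k h_{kl} r_{km} t_{kn}`. -/
noncomputable def score {d P : ℕ} (W : Fin P → Fin P → Fin P → ℝ)
    (h r t : Fin d → Fin P → ℝ) : ℝ :=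
  ∑ l, ∑ m, ∑ n, W l m n * ∑ k, h k l * r k m * t k n

/-- The transposed mode-2 unfolding `W_(2)ᵀ`: the P²×P matrix whose entry in
row (l,n) and column m is `W_{lmn}`. -/
def W2T {P : ℕ} (W : Fin P → Fin P → Fin P → ℝ) :
    Matrix (Fin P × Fin P) (Fin P) ℝ :=
  Matrix.of fun ln m => W ln.1 m ln.2

/-- The swap permutation matrix `S` with `S_{(i,j),(j,i)} = 1` and other entries 0. -/
def swapMat (P : ℕ) : Matrix (Fin P × Fin P) (Fin P × Fin P) ℝ :=
  Matrix.of fun p q => if p.1 = q.2 ∧ p.2 = q.1 then 1 else 0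

theorem score_eq_aux {d P : ℕ} (W : Fin P → Fin P → Fin P → ℝ)
    (h r t : Fin d → Fin P → ℝ) :
    score W h r t = ∑ k, ∑ l, ∑ n, h k l * t k n * ∑ m, W l m n * r k m := by
  unfold score
  rw [Finset.sum_comm' (s := Finset.univ) (t := fun _ => Finset.univ)
    (t' := Finset.univ) (s' := fun _ => Finset.univ) (by simp)]
  simp only [Finset.mul_sum]
  have e1 : ∀ (F : Fin P → Fin P → Fin P → Fin d → ℝ),
      ∑ m, ∑ l, ∑ n, ∑ k, F l m n k = ∑ k, ∑ l, ∑ n, ∑ m, F l m n k := by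
    intro F
    calc ∑ m, ∑ l, ∑ n, ∑ k, F l m n k = ∑ m, ∑ l, ∑ k, ∑ n, F l m n k :=
          Finset.sum_congr rfl fun m _ => Finset.sum_congr rfl fun l _ => Finset.sum_comm
      _ = ∑ m, ∑ k, ∑ l, ∑ n, F l m n k :=
          Finset.sum_congr rfl fun m _ => Finset.sum_comm
      _ = ∑ k, ∑ m, ∑ l, ∑ n, F l m n k := Finset.sum_comm
      _ = ∑ k, ∑ l, ∑ m, ∑ n, F l m n k :=
          Finset.sum_congr rfl fun m _ => Finset.sum_comm
      _ = _ :=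
          Finset.sum_congr rfl fun m _ => Finset.sum_congr rfl fun l _ => Finset.sum_comm
  rw [e1]
  refine Finset.sum_congr rfl fun k _ => Finset.sum_congr rfl fun l _ =>
    Finset.sum_congr rfl fun n _ => Finset.sum_congr rfl fun m _ => by ring

theorem mat_apply_aux {P : ℕ} (W : Fin P → Fin P → Fin P → ℝ) (l n m : Fin P) :
    (W2T W - swapMat P * W2T W) (l, n) m = W l m n - W n m l := by
  rw [Matrix.sub_apply, Matrix.mul_apply, Fintype.sum_prod_type]
  simp [W2T, swapMat, ite_and]

theorem mulVec_aux {P : ℕ} (W : Fin P → Fin P → Fin P → ℝ) (v : Fin P → ℝ) :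
    (W2T W - swapMat P * W2T W) *ᵥ v = 0 ↔
      ∀ l n, ∑ m, W l m n * v m = ∑ m, W n m l * v m := by
  rw [funext_iff, Prod.forall]
  refine forall_congr' fun l => forall_congr' fun n => ?_
  simp only [Matrix.mulVec, dotProduct, mat_apply_aux, Pi.zero_apply, sub_mul,
    Finset.sum_sub_distrib, sub_eq_zero]

theorem rank_aux {ι : Type*} [Fintype ι] {P : ℕ} (M : Matrix ι (Fin P) ℝ) :
    M.rank < P ↔ ∃ v, v ≠ 0 ∧ M *ᵥ v = 0 := by
  have h := LinearMap.finrank_range_add_finrank_ker M.mulVecLin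
  rw [Module.finrank_fin_fun] at h
  have h2 : M.rank < P ↔ LinearMap.ker M.mulVecLin ≠ ⊥ := by
    rw [Ne, ← Submodule.finrank_eq_zero (R := ℝ)]
    unfold Matrix.rank
    omega
  rw [h2, Submodule.ne_bot_iff]
  simp [and_comm]

/-- the model can learn symmetry rules iff
`rank(W_(2)ᵀ − S·W_(2)ᵀ) < P`. -/
theorem stmt11 {d P : ℕ} (hd : 1 ≤ d) (hP : 1 ≤ P)
    (W : Fin P → Fin P → Fin P → ℝ) :
    (∃ r : Fin d → Fin P → ℝ, r ≠ 0 ∧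
        ∀ h t : Fin d → Fin P → ℝ, score W h r t = score W t r h) ↔
      (W2T W - swapMat P * W2T W).rank < P := by
  rw [rank_aux]
  simp only [mulVec_aux, score_eq_aux]
  constructor
  · rintro ⟨r, hr, H⟩
    obtain ⟨k, hk⟩ := Function.ne_iff.1 hr
    refine ⟨r k, hk, fun l n => ?_⟩
    have key : ∀ (a b : Fin P), ∑ kk, ∑ ll, ∑ nn,
        (if kk = k then (if ll = a then (1:ℝ) else 0) else 0) *
        (if kk = k then (if nn = b then (1:ℝ) else 0) else 0) *
          ∑ m, W ll m nn * r kk m = ∑ m, W a m b * r k m := by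
      intro a b
      rw [Finset.sum_eq_single k (by intro c _ hc; simp [hc]) (by simp),
        Finset.sum_eq_single a (by intro c _ hc; simp [hc]) (by simp),
        Finset.sum_eq_single b (by intro c _ hc; simp [hc]) (by simp)]
      simp
    have := H (fun kk ll => if kk = k then (if ll = l then 1 else 0) else 0)
      (fun kk ll => if kk = k then (if ll = n then 1 else 0) else 0)
    rwa [key, key] at this
  · rintro ⟨v, hv, H⟩
    refine ⟨fun _ => v, fun h0 => hv (congrFun h0 ⟨0, hd⟩), fun h t => ?_⟩
    refine Finset.sum_congr rfl fun k _ => ?_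
    rw [Finset.sum_comm]
    refine Finset.sum_congr rfl fun l _ => Finset.sum_congr rfl fun n _ => ?_
    rw [H n l, mul_comm (h k n)]
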